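/- Let n ≥ 2 and let G be a connected simple graph on the vertex set {0, 1, ..., n−1} whose edges are pairwise non-crossing chords of the circular order, with positive integer capacities u(e), and let (s_1,t_1), ..., (s_k,t_k) be request pairs with nonnegative real weights w_1, ..., w_k. Then there exists a spanning tree T of G with nonnegative integer capacities û(e) on its edges such that: (i) every subset S of the requests that is routable in T with capacities û is routable in G with capacities u; and (ii) for every subset S of the requests that is routable in G with capacities u, there exists a subset S' ⊆ S that is routable in T with capacities û and satisfies Σ_{i∈S'} w_i ≥ (1/56)·Σ_{i∈S} w_i. -/

import Mathlib

open SimpleGraph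
open scoped Classical

/-- A set of edges (chords) on the circularly ordered vertex set `{0, …, n-1}` is
non-crossing if no two of its chords `{a,b}` and `{c,d}` satisfy `a < c < b < d`. -/
def NonCrossing (n : ℕ) (E : Set (Sym2 (Fin n))) : Prop :=
  ∀ a b c d : Fin n, a < c → c < b → b < d → s(a, b) ∈ E → s(c, d) ∈ E → False

/-- The subfamily `S` of the requests `(sdem i, tdem i)` is (integrally) routable in `G`
with capacities `u`: there are paths, one joining `sdem i` to `tdem i` for each `i ∈ S`,
such that every edge `e` lies on at most `u e` of the paths. -/
def RoutableOn {n : ℕ} (G : SimpleGraph (Fin n)) (u : Sym2 (Fin n) → ℕ)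
    {k : ℕ} (sdem tdem : Fin k → Fin n) (S : Finset (Fin k)) : Prop :=
  ∃ P : (i : {i : Fin k // i ∈ S}) → G.Walk (sdem i.1) (tdem i.1),
    (∀ i, (P i).IsPath) ∧
    ∀ e : Sym2 (Fin n),
      (Finset.univ.filter (fun i : {i : Fin k // i ∈ S} => e ∈ (P i).edges)).card ≤ u e


/-! ### Set-based routing and an additive preorder on capacities -/

/-- `x` and `y` are connected through the edges of `A`. -/
def Reach {n : ℕ} (A : Finset (Sym2 (Fin n))) (x y : Fin n) : Prop :=
  Relation.ReflTransGen (fun a b => s(a, b) ∈ A) x y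

/-- Set-based routability with capacities `c` on all pairs. -/
def Rt {n k : ℕ} (c : Sym2 (Fin n) → ℕ) (s t : Fin k → Fin n) (S : Finset (Fin k)) : Prop :=
  ∃ A : Fin k → Finset (Sym2 (Fin n)), (∀ i ∈ S, Reach (A i) (s i) (t i)) ∧
    ∀ e, (S.filter (fun i => e ∈ A i)).card ≤ c e

/-- Everything routable with capacity `c` (plus context) is routable with `d` (plus context). -/
def CLe {n : ℕ} (c d : Sym2 (Fin n) → ℕ) : Prop :=
  ∀ (k : ℕ) (s t : Fin k → Fin n) (S : Finset (Fin k)) (w : Sym2 (Fin n) → ℕ),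
    Rt (c + w) s t S → Rt (d + w) s t S

lemma Reach.mono {n : ℕ} {A B : Finset (Sym2 (Fin n))} (h : A ⊆ B) {x y : Fin n}
    (hr : Reach A x y) : Reach B x y :=
  Relation.ReflTransGen.mono (fun _ _ hab => h hab) _ _ hr

lemma Reach.symm {n : ℕ} {A : Finset (Sym2 (Fin n))} {x y : Fin n}
    (hr : Reach A x y) : Reach A y x := by
  induction hr with
  | refl => exact Relation.ReflTransGen.refl
  | tail _ h ih => exact Relation.ReflTransGen.head (by rw [Sym2.eq_swap]; exact h) ih

lemma Rt.mono {n k : ℕ} {c d : Sym2 (Fin n) → ℕ} (h : ∀ e, c e ≤ d e) {s t : Fin k → Fin n}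
    {S : Finset (Fin k)} (hr : Rt c s t S) : Rt d s t S := by
  obtain ⟨A, h1, h2⟩ := hr
  exact ⟨A, h1, fun e => (h2 e).trans (h e)⟩

lemma CLe.of_le {n : ℕ} {c d : Sym2 (Fin n) → ℕ} (h : ∀ e, c e ≤ d e) : CLe c d :=
  fun _ _ _ _ w hr => hr.mono (fun e => Nat.add_le_add_right (h e) (w e))

lemma CLe.refl {n : ℕ} (c : Sym2 (Fin n) → ℕ) : CLe c c := fun _ _ _ _ _ hr => hr

lemma CLe.trans {n : ℕ} {c d f : Sym2 (Fin n) → ℕ} (h : CLe c d) (h' : CLe d f) : CLe c f :=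
  fun k s t S w hr => h' k s t S w (h k s t S w hr)

lemma CLe.add {n : ℕ} {c d c' d' : Sym2 (Fin n) → ℕ} (h : CLe c d) (h' : CLe c' d') :
    CLe (c + c') (d + d') := by
  intro k s t S w hr
  rw [add_assoc] at hr
  have h1 := h k s t S _ hr
  have h2 : Rt (c' + (d + w)) s t S := by
    convert h1 using 1; abel
  have h3 := h' k s t S _ h2
  convert h3 using 1; abel

lemma CLe.nsmul {n : ℕ} {c d : Sym2 (Fin n) → ℕ} (h : CLe c d) (m : ℕ) :
    CLe (m • c) (m • d) := by
  induction m with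
  | zero => simpa using CLe.refl _
  | succ m ih => rw [succ_nsmul, succ_nsmul]; exact ih.add h

/-- Unit capacity on one pair. -/
def Un {n : ℕ} (e : Sym2 (Fin n)) : Sym2 (Fin n) → ℕ := fun f => if f = e then 1 else 0

lemma CLe.triangle {n : ℕ} {x y z : Fin n} (hxy : x ≠ y) (hyz : y ≠ z) (hxz : x ≠ z) :
    CLe (Un s(x, z)) (Un s(x, y) + Un s(y, z)) := by
  intro k s t S w hr
  obtain ⟨A, h1, h2⟩ := hr
  have hne1 : s(x, z) ≠ s(x, y) := by simp; grind
  have hne2 : s(x, z) ≠ s(y, z) := by simp; grind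
  by_cases hc : (S.filter (fun i => s(x, z) ∈ A i)).card ≤ w s(x, z)
  · refine ⟨A, h1, fun e => ?_⟩
    by_cases he : e = s(x, z)
    · subst he; simp only [Pi.add_apply]; omega
    · have := h2 e
      simp only [Pi.add_apply, Un, he, if_false] at this ⊢; omega
  · have hpos : 0 < (S.filter (fun i => s(x, z) ∈ A i)).card := by omega
    obtain ⟨i0, hi0⟩ := Finset.card_pos.mp hpos
    obtain ⟨hi0S, hi0A⟩ := Finset.mem_filter.mp hi0
    refine ⟨fun i => if i = i0 then insert s(x, y) (insert s(y, z) ((A i).erase s(x, z))) else A i,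
      ?_, ?_⟩
    · intro i hi
      by_cases hii : i = i0
      · subst hii
        simp only [if_true]
        have := h1 i hi
        unfold Reach at this ⊢
        generalize t i = ti at this
        clear h1 h2 hc hpos
        induction this with
        | refl => exact Relation.ReflTransGen.refl
        | @tail b c _ hbc ih =>
          refine ih.trans ?_
          by_cases hb : s(b, c) = s(x, z)
          · rw [Sym2.eq_iff] at hb
            rcases hb with ⟨rfl, rfl⟩ | ⟨rfl, rfl⟩
            · exact (Relation.ReflTransGen.single (by simp)).tail (b := y) (by simp)
            · exact (Relation.ReflTransGen.single (b := y) (by simp [Sym2.eq_swap])).tail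
                (by rw [Sym2.eq_swap]; simp)
          · exact Relation.ReflTransGen.single (by simp [hb, hbc])
      · simpa [hii] using h1 i hi
    · intro e
      by_cases he : e = s(x, z)
      · subst he
        have hsub : S.filter (fun i => s(x, z) ∈ (if i = i0 then insert s(x, y) (insert s(y, z)
            ((A i).erase s(x, z))) else A i)) ⊆ (S.filter (fun i => s(x, z) ∈ A i)).erase i0 := by
          intro i hi
          simp only [Finset.mem_filter, Finset.mem_erase] at hi ⊢
          by_cases hii : i = i0
          · simp [hii, hne1, hne2] at hi
          · simp only [hii, if_false] at hi; exact ⟨hii, hi⟩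
        have h3 := Finset.card_le_card hsub
        rw [Finset.card_erase_of_mem hi0] at h3
        have h4 := h2 s(x, z)
        simp only [Pi.add_apply, Un, if_true] at h4 ⊢
        omega
      · have h4 := h2 e
        simp only [Pi.add_apply, Un, he, if_false] at h4 ⊢
        by_cases he2 : e = s(x, y) ∨ e = s(y, z)
        · have hsub : S.filter (fun i => e ∈ (if i = i0 then insert s(x, y) (insert s(y, z)
            ((A i).erase s(x, z))) else A i)) ⊆ insert i0 (S.filter (fun i => e ∈ A i)) := by
            intro i hi
            simp only [Finset.mem_filter, Finset.mem_insert] at hi ⊢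
            by_cases hii : i = i0
            · exact Or.inl hii
            · simp only [hii, if_false] at hi; exact Or.inr hi
          have h3 := (Finset.card_le_card hsub).trans (Finset.card_insert_le _ _)
          have : 1 ≤ (if e = s(x, y) then 1 else 0) + (if e = s(y, z) then 1 else 0) := by
            rcases he2 with h | h <;> simp [h]
          omega
        · push Not at he2
          have hsub : S.filter (fun i => e ∈ (if i = i0 then insert s(x, y) (insert s(y, z)
            ((A i).erase s(x, z))) else A i)) ⊆ (S.filter (fun i => e ∈ A i)) := by
            intro i hi
            simp only [Finset.mem_filter] at hi ⊢
            by_cases hii : i = i0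
            · subst hii; simpa [he, he2.1, he2.2] using hi
            · simp only [hii, if_false] at hi; exact hi
          have h3 := (Finset.card_le_card hsub)
          simp only [he2.1, he2.2, if_false]
          omega

/-! ### The recursive construction -/

/-- Bookkeeping for tree capacities `a` and loads `x` inside the capacity function `v`. -/
def Ok {n : ℕ} (v a x : Sym2 (Fin n) → ℕ) (N : ℕ) : Prop :=
  (∀ e, a e ≠ 0 → v e ≠ 0) ∧ (∀ e, a e = 0 → x e = 0) ∧ (∀ e, x e ≤ 14 * a e + 13) ∧
    (Finset.univ.filter (fun e => a e ≠ 0)).card ≤ N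

lemma Ok.add {n : ℕ} {v v' a a' x x' : Sym2 (Fin n) → ℕ} {N N' : ℕ}
    (hd : ∀ e, v e = 0 ∨ v' e = 0) (h : Ok v a x N) (h' : Ok v' a' x' N') :
    Ok (v + v') (a + a') (x + x') (N + N') := by
  obtain ⟨h1, h2, h3, h4⟩ := h
  obtain ⟨h1', h2', h3', h4'⟩ := h'
  refine ⟨fun e he => ?_, fun e he => ?_, fun e => ?_, ?_⟩
  · have := h1 e; have := h1' e
    simp only [Pi.add_apply] at he ⊢; omega
  · have := h2 e; have := h2' e
    simp only [Pi.add_apply] at he ⊢; omega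
  · have := hd e; have := h1 e; have := h1' e
    have := h2 e; have := h2' e; have := h3 e; have := h3' e
    simp only [Pi.add_apply]; omega
  · refine le_trans (Finset.card_le_card ?_) ((Finset.card_union_le _ _).trans
      (Nat.add_le_add h4 h4'))
    intro e he
    simp only [Finset.mem_filter, Finset.mem_union, Finset.mem_univ, true_and,
      Pi.add_apply] at he ⊢
    omega

lemma Ok.single {n : ℕ} (e : Sym2 (Fin n)) {v a x : ℕ} (hv : v ≠ 0) (ha : a ≠ 0)
    (hx : x ≤ 14 * a + 13) : Ok (v • Un e) (a • Un e) (x • Un e) 1 := by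
  refine ⟨fun f => ?_, fun f => ?_, fun f => ?_, ?_⟩
  · by_cases h : f = e <;> simp [Un, h, hv]
  · by_cases h : f = e <;> simp [Un, h, ha]
  · by_cases h : f = e <;> simp [Un, h, hx]
  · refine (Finset.card_le_card (t := {e}) ?_).trans (by simp)
    intro f hf
    by_contra h
    simp [Un] at hf h
    exact h hf.1

lemma Ok.mono {n : ℕ} {v v' a x : Sym2 (Fin n) → ℕ} {N N' : ℕ} (h : Ok v a x N)
    (hv : ∀ e, v e ≤ v' e) (hN : N ≤ N') : Ok v' a x N' := by
  obtain ⟨h1, h2, h3, h4⟩ := h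
  exact ⟨fun e he => by have := h1 e he; have := hv e; omega, h2, h3, h4.trans hN⟩

lemma Ok.zero {n : ℕ} (v : Sym2 (Fin n) → ℕ) (N : ℕ) : Ok v 0 0 N := by
  refine ⟨?_, ?_, ?_, ?_⟩ <;> simp

/-- Split mode. -/
def Splt {n : ℕ} (v : Sym2 (Fin n) → ℕ) (e : Sym2 (Fin n)) (N c : ℕ) : Prop :=
  ∃ (a x : Sym2 (Fin n) → ℕ) (Z : ℕ), Ok v a x (N - 1) ∧ c ≤ 3 * Z + 2 ∧
    CLe (a + Z • Un e) v ∧ CLe v (x + c • Un e)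

/-- Connected mode. -/
def Conn {n : ℕ} (v : Sym2 (Fin n) → ℕ) (e : Sym2 (Fin n)) (N c D : ℕ) : Prop :=
  ∃ (a x : Sym2 (Fin n) → ℕ) (Z : ℕ), Ok v a x N ∧ 2 * c ≤ 3 * Z + 2 + D ∧
    CLe (a + Z • Un e) v ∧ CLe (v + D • Un e) x

def Good {n : ℕ} (v : Sym2 (Fin n) → ℕ) (e : Sym2 (Fin n)) (N c : ℕ) : Prop :=
  1 ≤ N ∧ Splt v e N c ∧ ∀ D, 1 ≤ c → D ≤ 2 * c → Conn v e N c D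

lemma Good.leaf {n : ℕ} (e : Sym2 (Fin n)) (c : ℕ) : Good (c • Un e) e 1 c := by
  refine ⟨le_rfl, ⟨0, 0, c, Ok.zero _ _, by omega, ?_, ?_⟩, fun D hc hD => ?_⟩
  · rw [zero_add]; exact CLe.refl _
  · rw [zero_add]; exact CLe.refl _
  · refine ⟨(max 1 ((D + c) / 14)) • Un e, (D + c) • Un e, c - max 1 ((D + c) / 14),
      Ok.single e (by omega) (by omega) (by omega), by omega, ?_, ?_⟩
    · rw [← add_nsmul, Nat.add_sub_of_le (by omega)]; exact CLe.refl _
    · rw [← add_nsmul, add_comm]; exact CLe.refl _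

/-- The node step, with the first child the lighter one. -/
lemma Good.node_aux {n : ℕ} {v1 v2 : Sym2 (Fin n) → ℕ} {e e1 e2 : Sym2 (Fin n)}
    {N1 N2 c1 c2 : ℕ} (u : ℕ) (h1 : Good v1 e1 N1 c1) (h2 : Good v2 e2 N2 c2)
    (hle : c1 ≤ c2) (hpos : 1 ≤ c2)
    (hd : ∀ f, v1 f = 0 ∨ v2 f = 0) (he1 : v1 e = 0) (he2 : v2 e = 0)
    (t : CLe (Un e) (Un e1 + Un e2)) (t1 : CLe (Un e1) (Un e + Un e2)) :
    Good (v1 + v2 + u • Un e) e (N1 + N2) (u + c1) := by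
  obtain ⟨hN1, s1, g1⟩ := h1
  obtain ⟨hN2, s2, g2⟩ := h2
  obtain ⟨a1, x1, Z1, ok1, hZ1, lo1, up1⟩ := s1
  obtain ⟨a2, x2, Z2, ok2, hZ2, lo2, up2⟩ := g2 c1 hpos (by omega)
  have hlow : ∀ {a1 a2 : Sym2 (Fin n) → ℕ} {Z1 Z2 : ℕ}, CLe (a1 + Z1 • Un e1) v1 →
      CLe (a2 + Z2 • Un e2) v2 →
      CLe (a1 + a2 + (u + min Z1 Z2) • Un e) (v1 + v2 + u • Un e) := by
    intro a1 a2 Z1 Z2 lo1 lo2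
    have k1 : CLe (a1 + (min Z1 Z2) • Un e1) v1 := (CLe.of_le (fun f => by
      simp only [Pi.add_apply, Pi.smul_apply, smul_eq_mul]; gcongr; omega)).trans lo1
    have k2 : CLe (a2 + (min Z1 Z2) • Un e2) v2 := (CLe.of_le (fun f => by
      simp only [Pi.add_apply, Pi.smul_apply, smul_eq_mul]; gcongr; omega)).trans lo2
    have k3 := ((k1.add k2).add (CLe.refl (u • Un e)))
    have k4 := (CLe.refl (a1 + a2 + u • Un e)).add (t.nsmul (min Z1 Z2))
    rw [show a1 + a2 + (u + min Z1 Z2) • Un e = a1 + a2 + u • Un e + (min Z1 Z2) • Un e by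
      rw [add_nsmul]; abel]
    refine k4.trans ?_
    convert k3 using 1
    rw [nsmul_add]; abel
  have hup : ∀ D, CLe (v1 + v2 + u • Un e + D • Un e) (x1 + x2 + (D + u + c1) • Un e) := by
    intro D
    have k1 := (up1.add (CLe.refl v2)).add (CLe.refl (u • Un e + D • Un e))
    have k2 := (CLe.refl (x1 + v2 + (u • Un e + D • Un e))).add (t1.nsmul c1)
    have k3 := (CLe.refl (x1 + (D + u + c1) • Un e)).add up2
    rw [show v1 + v2 + u • Un e + D • Un e = v1 + v2 + (u • Un e + D • Un e) by abel]
    refine k1.trans ?_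
    rw [show x1 + c1 • Un e1 + v2 + (u • Un e + D • Un e) =
      x1 + v2 + (u • Un e + D • Un e) + c1 • Un e1 by abel]
    refine k2.trans ?_
    rw [show x1 + v2 + (u • Un e + D • Un e) + c1 • (Un e + Un e2) =
      x1 + (D + u + c1) • Un e + (v2 + c1 • Un e2) by
        rw [nsmul_add, add_nsmul, add_nsmul]; abel]
    convert k3 using 1
    abel
  refine ⟨by omega, ⟨a1 + a2, x1 + x2, u + min Z1 Z2, ?_, by omega, hlow lo1 lo2, ?_⟩, ?_⟩
  · refine (Ok.add hd ok1 ok2).mono (fun f => ?_) (by omega)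
    simp
  · have := hup 0
    simpa using this
  · intro D hc hD
    by_cases hcut : D + u ≤ 2 * c1
    · obtain ⟨a1, x1, Z1, ok1, hZ1, lo1, up1⟩ := g1 (D + u) (by omega) hcut
      obtain ⟨a2, x2, Z2, ok2, hZ2, lo2, up2⟩ := g2 (D + u) (by omega) (by omega)
      refine ⟨a1 + a2, x1 + x2, u + min Z1 Z2, ?_, by omega, hlow lo1 lo2, ?_⟩
      · refine (Ok.add hd ok1 ok2).mono (fun f => ?_) (by omega)
        simp
      · have k1 := (CLe.refl (v1 + v2)).add (t.nsmul (D + u))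
        rw [show v1 + v2 + u • Un e + D • Un e = v1 + v2 + (D + u) • Un e by
          rw [add_nsmul]; abel]
        refine k1.trans ?_
        convert up1.add up2 using 1
        rw [nsmul_add]; abel
    · have hu1 : 1 ≤ u := by omega
      have hw : max 1 ((D + u + c1) / 14) ≤ u + min Z1 Z2 := by omega
      refine ⟨a1 + a2 + (max 1 ((D + u + c1) / 14)) • Un e, x1 + x2 + (D + u + c1) • Un e,
        u + min Z1 Z2 - max 1 ((D + u + c1) / 14), ?_, by omega, ?_, hup D⟩
      · refine (Ok.add (fun f => ?_) (Ok.add hd ok1 ok2) (Ok.single e (v := u) (by omega)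
          (by omega) (by omega))).mono (fun f => le_rfl) (by omega)
        by_cases hf : f = e
        · left; subst hf; simp [he1, he2]
        · right; simp [Un, hf]
      · have := hlow lo1 lo2
        rw [add_assoc, ← add_nsmul, Nat.add_sub_of_le hw]
        exact this

lemma Good.node {n : ℕ} {v1 v2 : Sym2 (Fin n) → ℕ} {e e1 e2 : Sym2 (Fin n)}
    {N1 N2 c1 c2 : ℕ} (u : ℕ) (h1 : Good v1 e1 N1 c1) (h2 : Good v2 e2 N2 c2)
    (hpos : 1 ≤ c1 ∨ 1 ≤ c2)
    (hd : ∀ f, v1 f = 0 ∨ v2 f = 0) (he1 : v1 e = 0) (he2 : v2 e = 0)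
    (t : CLe (Un e) (Un e1 + Un e2)) (t1 : CLe (Un e1) (Un e + Un e2))
    (t2 : CLe (Un e2) (Un e + Un e1)) :
    Good (v1 + v2 + u • Un e) e (N1 + N2) (u + min c1 c2) := by
  rcases le_total c1 c2 with h | h
  · rw [min_eq_left h]
    exact Good.node_aux u h1 h2 h (by omega) hd he1 he2 t t1
  · rw [min_eq_right h, add_comm v1, add_comm N1]
    exact Good.node_aux u h2 h1 h (by omega) (fun f => (hd f).symm) he2 he1
      (by rw [add_comm]; exact t) t2

/-! ### Interval induction -/

/-- Capacities restricted to pairs inside `[a, b]`. -/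
def rest {n : ℕ} (u : Sym2 (Fin n) → ℕ) (a b : Fin n) : Sym2 (Fin n) → ℕ :=
  fun e => if ∀ x ∈ e, a ≤ x ∧ x ≤ b then u e else 0

lemma rest_mk {n : ℕ} (u : Sym2 (Fin n) → ℕ) (a b x y : Fin n) :
    rest u a b s(x, y) = if (a ≤ x ∧ x ≤ b) ∧ (a ≤ y ∧ y ≤ b) then u s(x, y) else 0 := by
  simp [rest]

lemma closed_univ {n : ℕ} {G : SimpleGraph (Fin n)} (hconn : G.Connected) (Y : Set (Fin n))
    (hY : ∀ x y, G.Adj x y → x ∈ Y → y ∈ Y) {m : Fin n} (hm : m ∈ Y) (z : Fin n) : z ∈ Y := by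
  obtain ⟨p⟩ := hconn.preconnected m z
  induction p with
  | nil => exact hm
  | cons h _ ih => exact ih (hY _ _ h hm)

lemma exists_split {n : ℕ} {G : SimpleGraph (Fin n)} (hnc : NonCrossing n G.edgeSet)
    (a b : Fin n) (hab : (a : ℕ) + 1 < b) :
    ∃ m, a < m ∧ m < b ∧ ∀ x y, G.Adj x y → x < y → a ≤ x → y ≤ b → ¬ (x = a ∧ y = b) →
      y ≤ m ∨ m ≤ x := by
  by_cases hex : ∃ y, a < y ∧ y < b ∧ G.Adj a y
  · obtain ⟨m, hm, hmax⟩ := Finset.exists_max_image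
      (Finset.univ.filter (fun y => a < y ∧ y < b ∧ G.Adj a y)) id
      (by obtain ⟨y, hy⟩ := hex; exact ⟨y, by simpa using hy⟩)
    simp only [Finset.mem_filter, Finset.mem_univ, true_and, id] at hm hmax
    refine ⟨m, hm.1, hm.2.1, fun x y hxy hlt hax hyb hne => ?_⟩
    by_contra hcon
    push Not at hcon
    rcases hax.eq_or_lt with rfl | hax
    · have hyb' : y < b := lt_of_le_of_ne hyb (fun h => hne ⟨rfl, h⟩)
      exact absurd (hmax y ⟨hlt, hyb', hxy⟩) (not_le.mpr hcon.1)
    · exact hnc a m x y hax hcon.2 hcon.1 hm.2.2 hxy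
  · have hln : (a : ℕ) + 1 < n := by have := b.2; omega
    refine ⟨⟨a + 1, hln⟩, by rw [Fin.lt_def]; simp, by rw [Fin.lt_def]; simpa using hab,
      fun x y hxy hlt hax hyb hne => ?_⟩
    by_contra hcon
    push Not at hcon
    have hxa : x = a := by
      have := hcon.2; rw [Fin.lt_def] at this; rw [Fin.le_def] at hax
      simp only at this
      apply Fin.ext; omega
    subst hxa
    exact hex ⟨y, hlt, lt_of_le_of_ne hyb (fun h => hne ⟨rfl, h⟩), hxy⟩

lemma interval {n : ℕ} {G : SimpleGraph (Fin n)} (hconn : G.Connected)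
    (hnc : NonCrossing n G.edgeSet) (u : Sym2 (Fin n) → ℕ)
    (hu : ∀ e, u e ≠ 0 ↔ e ∈ G.edgeSet) :
    ∀ (d : ℕ) (a b : Fin n), (b : ℕ) = a + d + 1 →
      (∀ x y, G.Adj x y → a < x → x < b → a ≤ y ∧ y ≤ b) →
      ∃ c, Good (rest u a b) s(a, b) (b - a) c ∧ (c = 0 → ∃ X : Set (Fin n), a ∈ X ∧ b ∉ X ∧
        (∀ x ∈ X, a ≤ x ∧ x ≤ b) ∧ ∀ x y, G.Adj x y → a ≤ x → x ≤ b → a ≤ y → y ≤ b →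
          x ∈ X → y ∈ X) := by
  intro d
  induction d using Nat.strong_induction_on with
  | _ d ih =>
  intro a b hb hNC
  have hadj : ∀ x y, G.Adj x y ↔ u s(x, y) ≠ 0 := fun x y => by
    rw [hu]; exact (SimpleGraph.mem_edgeSet G).symm
  have hdiag : ∀ x, u s(x, x) = 0 := fun x => by
    by_contra h; exact G.irrefl ((hadj x x).mpr h)
  have hltab : a < b := by rw [Fin.lt_def]; omega
  by_cases hd0 : d = 0
  · refine ⟨u s(a, b), ?_, fun hc => ⟨{a}, rfl, ?_, ?_, ?_⟩⟩
    · have h1 : rest u a b = u s(a, b) • Un s(a, b) := by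
        ext e
        induction e using Sym2.ind with
        | _ x y =>
        rw [rest_mk]
        by_cases he : s(x, y) = s(a, b)
        · rw [he]
          have : (a ≤ x ∧ x ≤ b) ∧ (a ≤ y ∧ y ≤ b) := by
            rw [Sym2.eq_iff] at he; rcases he with ⟨rfl, rfl⟩ | ⟨rfl, rfl⟩ <;>
            simp [hltab.le]
          simp [this, Un]
        · simp only [Un, Pi.smul_apply, he, if_false, smul_zero]
          split_ifs with hc
          · have : x = y := by
              simp only [Sym2.eq_iff, Fin.ext_iff] at he
              simp only [Fin.le_def] at hc
              apply Fin.ext; omega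
            subst this; exact hdiag x
          · rfl
      rw [h1, show (b : ℕ) - a = 1 by omega]
      exact Good.leaf _ _
    · simp only [Set.mem_singleton_iff]; exact hltab.ne'
    · rintro x rfl; exact ⟨le_rfl, hltab.le⟩
    · rintro x y hxy _ _ hy1 hy2 rfl
      by_contra hy
      have : y = b := by
        simp only [Set.mem_singleton_iff, Fin.ext_iff] at hy
        simp only [Fin.le_def] at hy1 hy2
        apply Fin.ext; omega
      subst this
      exact (hadj _ _).mp hxy hc
  · obtain ⟨m, ham, hmb, hsp⟩ := exists_split hnc a b (by omega)
    have ham' := ham; have hmb' := hmb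
    rw [Fin.lt_def] at ham' hmb'
    have hsp2 : ∀ x y, G.Adj x y → a ≤ x → x ≤ b → a ≤ y → y ≤ b → s(x, y) ≠ s(a, b) →
        (x ≤ m ∧ y ≤ m) ∨ (m ≤ x ∧ m ≤ y) := by
      intro x y hxy h1 h2 h3 h4 hne
      rcases lt_trichotomy x y with h | h | h
      · rcases hsp x y hxy h h1 h4 (fun hh => hne (by rw [hh.1, hh.2])) with h' | h'
        · exact Or.inl ⟨h.le.trans h', h'⟩
        · exact Or.inr ⟨h', h'.trans h.le⟩
      · subst h; exact absurd hxy G.irrefl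
      · rcases hsp y x hxy.symm h h3 h2 (fun hh => hne (by rw [hh.1, hh.2, Sym2.eq_swap]))
          with h' | h'
        · exact Or.inl ⟨h', h.le.trans h'⟩
        · exact Or.inr ⟨h'.trans h.le, h'⟩
    have hsne : ∀ x y, a < x → x < b → s(x, y) ≠ s(a, b) := by
      intro x y h1 h2 h
      rw [Sym2.eq_iff] at h
      rcases h with ⟨rfl, rfl⟩ | ⟨rfl, rfl⟩
      · exact lt_irrefl _ h1
      · exact lt_irrefl _ h2
    obtain ⟨c1, g1, z1⟩ := ih ((m : ℕ) - a - 1) (by omega) a m (by omega) (by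
      intro x y hxy h1 h2
      obtain ⟨h3, h4⟩ := hNC x y hxy h1 (h2.trans hmb)
      refine ⟨h3, ?_⟩
      rcases hsp2 x y hxy h1.le (h2.trans hmb).le h3 h4 (hsne x y h1 (h2.trans hmb)) with h | h
      · exact h.2
      · exact absurd h.1 (not_le.mpr h2))
    obtain ⟨c2, g2, z2⟩ := ih ((b : ℕ) - m - 1) (by omega) m b (by omega) (by
      intro x y hxy h1 h2
      obtain ⟨h3, h4⟩ := hNC x y hxy (ham.trans h1) h2
      refine ⟨?_, h4⟩
      rcases hsp2 x y hxy (ham.trans h1).le h2.le h3 h4 (hsne x y (ham.trans h1) h2) with h | h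
      · exact absurd h.1 (not_le.mpr h1)
      · exact h.2)
    have hpos : 1 ≤ c1 ∨ 1 ≤ c2 := by
      by_contra hcon
      obtain ⟨X1, ha1, hm1, hX1, hc1⟩ := z1 (by omega)
      obtain ⟨X2, hm2, hb2, hX2, hc2⟩ := z2 (by omega)
      have := closed_univ hconn ({x | a ≤ x ∧ x ≤ m ∧ x ∉ X1} ∪ X2) (by
        intro x y hxy hx
        have hxa : a < x := by
          rcases hx with hx | hx
          · refine lt_of_le_of_ne hx.1 ?_
            rintro rfl; exact hx.2.2 ha1
          · exact ham.trans_le (hX2 x hx).1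
        have hxb : x < b := by
          rcases hx with hx | hx
          · exact hx.2.1.trans_lt hmb
          · refine lt_of_le_of_ne (hX2 x hx).2 ?_
            rintro rfl; exact hb2 hx
        obtain ⟨h3, h4⟩ := hNC x y hxy hxa hxb
        rcases hsp2 x y hxy hxa.le hxb.le h3 h4 (hsne x y hxa hxb) with h | h
        · left
          refine ⟨h3, h.2, fun hy => ?_⟩
          have hx1 := hc1 y x hxy.symm h3 h.2 hxa.le h.1 hy
          rcases hx with hx | hx
          · exact hx.2.2 hx1
          · have : x = m := le_antisymm h.1 (hX2 x hx).1
            subst this; exact hm1 hx1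
        · right
          have hx2 : x ∈ X2 := by
            rcases hx with hx | hx
            · have : x = m := le_antisymm hx.2.1 h.1
              subst this; exact hm2
            · exact hx
          exact hc2 x y hxy h.1 hxb.le h.2 h4 hx2) (Or.inr hm2 : m ∈ _) a
      rcases this with h | h
      · exact h.2.2 ha1
      · exact absurd (hX2 a h).1 (not_le.mpr ham)
    refine ⟨u s(a, b) + min c1 c2, ?_, ?_⟩
    · have heq : rest u a b = rest u a m + rest u m b + u s(a, b) • Un s(a, b) := by
        ext e
        induction e using Sym2.ind with
        | _ x y =>
        simp only [Pi.add_apply, rest_mk, Pi.smul_apply, smul_eq_mul, Un]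
        by_cases hz : u s(x, y) = 0
        · simp only [hz, ite_self]
          split_ifs with he
          · rw [← he, hz]
          · rfl
        · have hxy := (hadj x y).mpr hz
          have hxny := hxy.ne
          by_cases he : s(x, y) = s(a, b)
          · have h1 : (a ≤ x ∧ x ≤ b) ∧ (a ≤ y ∧ y ≤ b) := by
              rw [Sym2.eq_iff] at he; rcases he with ⟨rfl, rfl⟩ | ⟨rfl, rfl⟩ <;>
              simp [hltab.le]
            have h2 : ¬ ((a ≤ x ∧ x ≤ m) ∧ (a ≤ y ∧ y ≤ m)) := by
              rw [Sym2.eq_iff] at he; rcases he with ⟨rfl, rfl⟩ | ⟨rfl, rfl⟩ <;>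
              simp [hmb]
            have h3 : ¬ ((m ≤ x ∧ x ≤ b) ∧ (m ≤ y ∧ y ≤ b)) := by
              rw [Sym2.eq_iff] at he; rcases he with ⟨rfl, rfl⟩ | ⟨rfl, rfl⟩ <;>
              simp [ham]
            rw [if_pos h1, if_neg h2, if_neg h3, if_pos he, he]; simp
          · rw [if_neg he]
            have h5 := hsp2 x y hxy
            simp only [Fin.le_def, ne_eq, he, not_false_eq_true, forall_true_left] at h5 ⊢
            have hxny' : (x : ℕ) ≠ y := fun h => hxny (Fin.ext h)
            split_ifs <;> omega
      rw [heq, show (b : ℕ) - a = (m - a) + (b - m) by omega]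
      refine Good.node _ g1 g2 hpos ?_ ?_ ?_ ?_ ?_ ?_
      · intro e
        induction e using Sym2.ind with
        | _ x y =>
        by_cases hxy : x = y
        · subst hxy; left; simp [rest_mk, hdiag]
        · simp only [rest_mk]
          have hxny' : (x : ℕ) ≠ y := fun h => hxy (Fin.ext h)
          by_cases h : (a ≤ x ∧ x ≤ m) ∧ (a ≤ y ∧ y ≤ m)
          · right; rw [if_neg]; simp only [Fin.le_def] at h ⊢; omega
          · left; rw [if_neg h]
      · rw [rest_mk, if_neg]; simp [hmb]
      · rw [rest_mk, if_neg]; simp [ham]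
      · exact CLe.triangle ham.ne hmb.ne hltab.ne
      · rw [Sym2.eq_swap (a := m)]
        exact CLe.triangle hltab.ne hmb.ne' ham.ne
      · rw [Sym2.eq_swap (a := a) (b := b), Sym2.eq_swap (a := m) (b := b), add_comm,
          Sym2.eq_swap (a := b) (b := a), Sym2.eq_swap (a := b) (b := m)]
        rw [Sym2.eq_swap (a := a) (b := m)]
        exact CLe.triangle ham.ne' hltab.ne hmb.ne
    · intro hc
      have hu0 : u s(a, b) = 0 := by omega
      have hnab : ∀ x y, G.Adj x y → s(x, y) ≠ s(a, b) := by
        intro x y hxy h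
        rw [hadj, h] at hxy; exact hxy hu0
      by_cases hc1 : c1 = 0
      · obtain ⟨X1, ha1, hm1, hX1, hc1⟩ := z1 hc1
        refine ⟨X1, ha1, fun h => absurd (hX1 b h).2 (not_le.mpr hmb),
          fun x hx => ⟨(hX1 x hx).1, (hX1 x hx).2.trans hmb.le⟩, ?_⟩
        intro x y hxy h1 h2 h3 h4 hx
        rcases hsp2 x y hxy h1 h2 h3 h4 (hnab x y hxy) with h | h
        · exact hc1 x y hxy h1 h.1 h3 h.2 hx
        · have : x = m := le_antisymm (hX1 x hx).2 h.1
          subst this; exact absurd hx hm1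
      · obtain ⟨X2, hm2, hb2, hX2, hc2⟩ := z2 (by omega)
        refine ⟨{x | a ≤ x ∧ x ≤ m} ∪ X2, Or.inl ⟨le_rfl, ham.le⟩, ?_, ?_, ?_⟩
        · rintro (h | h)
          · exact absurd h.2 (not_le.mpr hmb)
          · exact hb2 h
        · rintro x (hx | hx)
          · exact ⟨hx.1, hx.2.trans hmb.le⟩
          · exact ⟨ham.le.trans (hX2 x hx).1, (hX2 x hx).2⟩
        · intro x y hxy h1 h2 h3 h4 hx
          rcases hsp2 x y hxy h1 h2 h3 h4 (hnab x y hxy) with h | h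
          · exact Or.inl ⟨h3, h.2⟩
          · right
            have hx2 : x ∈ X2 := by
              rcases hx with hx | hx
              · have : x = m := le_antisymm hx.2 h.1
                subst this; exact hm2
              · exact hx
            exact hc2 x y hxy h.1 h2 h.2 h4 hx2

/-- The single-tree capacity approximator. -/
lemma approximator {n : ℕ} (hn : 2 ≤ n) {G : SimpleGraph (Fin n)} (hconn : G.Connected)
    (hnc : NonCrossing n G.edgeSet) (u : Sym2 (Fin n) → ℕ)
    (hu : ∀ e, u e ≠ 0 ↔ e ∈ G.edgeSet) :
    ∃ a x : Sym2 (Fin n) → ℕ, Ok u a x (n - 1) ∧ CLe a u ∧ CLe u x := by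
  have h0 : 0 < n := by omega
  have h1 : n - 1 < n := by omega
  have hall : ∀ x : Fin n, (⟨0, h0⟩ : Fin n) ≤ x ∧ x ≤ ⟨n - 1, h1⟩ := fun x => by
    have := x.2
    simp only [Fin.le_def]; omega
  obtain ⟨c, g, z⟩ := interval hconn hnc u hu (n - 2) ⟨0, h0⟩ ⟨n - 1, h1⟩
    (by simp only; omega) (fun x y _ _ _ => hall y)
  have hr : rest u ⟨0, h0⟩ ⟨n - 1, h1⟩ = u := by
    ext e
    induction e using Sym2.ind with
    | _ x y => rw [rest_mk, if_pos ⟨hall x, hall y⟩]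
  rw [hr] at g
  have hc : 1 ≤ c := by
    by_contra hc
    obtain ⟨X, ha, hb, -, hX⟩ := z (by omega)
    exact hb (closed_univ hconn X (fun x y hxy hx => hX x y hxy (hall x).1 (hall x).2
      (hall y).1 (hall y).2 hx) ha _)
  obtain ⟨a, x, Z, ok, -, lo, up⟩ := g.2.2 0 hc (by omega)
  refine ⟨a, x, by simpa using ok, (CLe.of_le (fun e => ?_)).trans lo, by simpa using up⟩
  simp

/-! ### Colouring paths in a tree -/

/-- Trees built by adding leaves. -/
inductive LTree {n : ℕ} : Finset (Fin n) → Finset (Sym2 (Fin n)) → Prop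
  | single (v : Fin n) : LTree {v} ∅
  | add {U : Finset (Fin n)} {E : Finset (Sym2 (Fin n))} {v w : Fin n} :
      LTree U E → w ∈ U → v ∉ U → LTree (insert v U) (insert s(v, w) E)

lemma LTree.mem {n : ℕ} {U : Finset (Fin n)} {E : Finset (Sym2 (Fin n))} (h : LTree U E) :
    ∀ x y, s(x, y) ∈ E → x ∈ U ∧ y ∈ U := by
  induction h with
  | single v => intro x y h; simp at h
  | add h hw hv ih =>
    intro x y hxy
    rw [Finset.mem_insert] at hxy
    rcases hxy with hxy | hxy
    · rw [Sym2.eq_iff] at hxy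
      rcases hxy with ⟨rfl, rfl⟩ | ⟨rfl, rfl⟩ <;> simp [hw]
    · have := ih x y hxy
      simp [this]

lemma LTree.notMem {n : ℕ} {U : Finset (Fin n)} {E : Finset (Sym2 (Fin n))} (h : LTree U E)
    {v w : Fin n} (hv : v ∉ U) : s(v, w) ∉ E := fun hh => hv (h.mem v w hh).1

lemma LTree.card {n : ℕ} {U : Finset (Fin n)} {E : Finset (Sym2 (Fin n))} (h : LTree U E) :
    E.card + 1 = U.card := by
  induction h with
  | single v => simp
  | add h hw hv ih =>
    rw [Finset.card_insert_of_notMem hv, Finset.card_insert_of_notMem (h.notMem hv), ih]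

lemma merge {k : ℕ} (X : Finset (Fin k × Bool)) (r : ℕ) (hr : 1 ≤ r) (hX : X.card ≤ 14 * r + 13) :
    ∀ (N : ℕ) (f : Fin k × Bool → Fin k × Bool), (X.image f).card = N →
      (∀ l, (X.filter (fun x => f x = l)).card ≤ 28) →
      ∃ g : Fin k × Bool → Fin k × Bool, (∀ x ∈ X, g (f x) ∈ X.image f) ∧
        (∀ l, (X.filter (fun x => g (f x) = l)).card ≤ 28) ∧
        (X.image (fun x => g (f x))).card ≤ r := by
  intro N
  induction N using Nat.strong_induction_on with
  | _ N ih =>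
  intro f hN hf
  by_cases hNr : N ≤ r
  · exact ⟨id, fun x hx => Finset.mem_image_of_mem f hx, hf, by simpa [hN] using hNr⟩
  · have hex : ∃ l1 ∈ X.image f, ∃ l2 ∈ X.image f, l1 ≠ l2 ∧
        (X.filter (fun x => f x = l1)).card + (X.filter (fun x => f x = l2)).card ≤ 28 := by
      by_contra hcon
      push Not at hcon
      have hne : (X.image f).Nonempty := by
        rw [← Finset.card_pos]; omega
      obtain ⟨l0, hl0, hmin⟩ := Finset.exists_min_image (X.image f)
        (fun l => (X.filter (fun x => f x = l)).card) hne
      have hsum := Finset.card_eq_sum_card_image f X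
      rw [← Finset.add_sum_erase _ _ hl0] at hsum
      set w0 := (X.filter (fun x => f x = l0)).card with hw0
      have hge : ∀ l ∈ (X.image f).erase l0,
          max (29 - w0) 15 ≤ (X.filter (fun x => f x = l)).card := by
        intro l hl
        rw [Finset.mem_erase] at hl
        have h1 := hcon l0 hl0 l hl.2 hl.1.symm
        have h2 := hmin l hl.2
        omega
      have h3 := Finset.card_nsmul_le_sum _ _ _ hge
      rw [Finset.card_erase_of_mem hl0, hN, smul_eq_mul] at h3
      have h4 : r * max (29 - w0) 15 ≤ (N - 1) * max (29 - w0) 15 :=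
        Nat.mul_le_mul_right _ (by omega)
      obtain ⟨r', rfl⟩ : ∃ r', r = r' + 1 := ⟨r - 1, by omega⟩
      have h5 : r' * 15 ≤ r' * max (29 - w0) 15 := Nat.mul_le_mul_left _ (by omega)
      rw [Nat.add_mul] at h4
      omega
    obtain ⟨l1, hl1, l2, hl2, hne, hw⟩ := hex
    obtain ⟨g, hg1, hg2, hg3⟩ := ih ((X.image (fun x => if f x = l2 then l1 else f x)).card) (by
        rw [← hN]
        refine (Finset.card_le_card (t := (X.image f).erase l2) ?_).trans_lt
          (Finset.card_erase_lt_of_mem hl2)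
        intro l hl
        rw [Finset.mem_image] at hl
        obtain ⟨x, hx, rfl⟩ := hl
        rw [Finset.mem_erase]
        by_cases h : f x = l2
        · simp only [h, if_true]; exact ⟨hne, hl1⟩
        · simp only [h, if_false]; exact ⟨h, Finset.mem_image_of_mem f hx⟩)
      (fun x => if f x = l2 then l1 else f x) rfl (by
        intro l
        by_cases h1 : l = l1
        · subst h1
          refine le_trans (Finset.card_le_card ?_) ((Finset.card_union_le _ _).trans hw)
          intro x hx
          simp only [Finset.mem_filter, Finset.mem_union] at hx ⊢
          by_cases h : f x = l2
          · exact Or.inr ⟨hx.1, h⟩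
          · simp only [h, if_false] at hx; exact Or.inl hx
        · refine le_trans (Finset.card_le_card ?_) (hf l)
          intro x hx
          simp only [Finset.mem_filter] at hx ⊢
          by_cases h : f x = l2
          · simp only [h, if_true] at hx; exact absurd hx.2.symm h1
          · simpa only [h, if_false] using hx)
    refine ⟨fun l => g (if l = l2 then l1 else l), fun x hx => ?_, hg2, hg3⟩
    have := hg1 x hx
    rw [Finset.mem_image] at this
    obtain ⟨y, hy, hyx⟩ := this
    show g (if f x = l2 then l1 else f x) ∈ _
    rw [← hyx]
    by_cases h : f y = l2
    · simp only [h, if_true]; exact hl1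
    · simp only [h, if_false]; exact Finset.mem_image_of_mem f hy

lemma greedy {k : ℕ} (C : Fin k → Fin k → Prop) (hC : ∀ i j, C i j → C j i) (S S1 : Finset (Fin k))
    (hS1 : S1 ⊆ S) (hdeg : ∀ i ∈ S, (S.filter (fun j => j ≠ i ∧ C i j)).card ≤ 55)
    (col : Fin k → Fin 56) (hcol : ∀ i ∈ S1, ∀ j ∈ S1, i ≠ j → C i j → col i ≠ col j) :
    ∃ col' : Fin k → Fin 56, (∀ i ∈ S1, col' i = col i) ∧
      ∀ i ∈ S, ∀ j ∈ S, i ≠ j → C i j → col' i ≠ col' j := by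
  suffices h : ∀ Q : Finset (Fin k), Q ⊆ S → ∃ col' : Fin k → Fin 56, (∀ i ∈ S1, col' i = col i) ∧
      ∀ i ∈ S1 ∪ Q, ∀ j ∈ S1 ∪ Q, i ≠ j → C i j → col' i ≠ col' j by
    obtain ⟨c, h1, h2⟩ := h S (Finset.Subset.refl _)
    refine ⟨c, h1, ?_⟩
    rwa [Finset.union_eq_right.mpr hS1] at h2
  intro Q
  induction Q using Finset.induction_on with
  | empty => intro _; exact ⟨col, fun _ _ => rfl, by simpa using hcol⟩
  | insert q Q hq ih =>
    intro hQ
    obtain ⟨c, h1, h2⟩ := ih (fun x hx => hQ (Finset.mem_insert_of_mem hx))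
    by_cases hq1 : q ∈ S1
    · refine ⟨c, h1, ?_⟩
      have : S1 ∪ insert q Q = S1 ∪ Q := by
        ext x; simp only [Finset.mem_union, Finset.mem_insert]
        constructor
        · rintro (h | rfl | h)
          · exact Or.inl h
          · exact Or.inl hq1
          · exact Or.inr h
        · tauto
      rw [this]; exact h2
    · have hqS : q ∈ S := hQ (Finset.mem_insert_self _ _)
      obtain ⟨γ, hγ⟩ : ∃ γ, γ ∉ (S.filter (fun j => j ≠ q ∧ C q j)).image c := by
        by_contra hcon
        push Not at hcon
        have h3 : (Finset.univ : Finset (Fin 56)) ⊆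
          (S.filter (fun j => j ≠ q ∧ C q j)).image c := fun γ _ => hcon γ
        have h4 := (Finset.card_le_card h3).trans Finset.card_image_le
        have h5 := hdeg q hqS
        simp only [Finset.card_univ, Fintype.card_fin] at h4
        omega
      have hsub : ∀ j, j ∈ S1 ∪ insert q Q → j ≠ q → j ∈ S1 ∪ Q ∧ j ∈ S := by
        intro j hj hjq
        simp only [Finset.mem_union, Finset.mem_insert] at hj ⊢
        rcases hj with h | h | h
        · exact ⟨Or.inl h, hS1 h⟩
        · exact absurd h hjq
        · exact ⟨Or.inr h, hQ (Finset.mem_insert_of_mem h)⟩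
      have hgq : ∀ j, j ∈ S1 ∪ insert q Q → j ≠ q → C q j → γ ≠ c j := by
        intro j hj hjq hCj h
        apply hγ
        rw [h]
        exact Finset.mem_image_of_mem c (Finset.mem_filter.mpr ⟨(hsub j hj hjq).2, hjq, hCj⟩)
      refine ⟨fun i => if i = q then γ else c i, fun i hi => ?_, fun i hi j hj hij hCij => ?_⟩
      · have : i ≠ q := by rintro rfl; exact hq1 hi
        simp only [this, if_false]; exact h1 i hi
      · by_cases hiq : i = q
        · subst hiq
          simp only [if_true, hij.symm, if_false]
          exact hgq j hj hij.symm hCij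
        · by_cases hjq : j = q
          · subst hjq
            simp only [if_true, hiq, if_false]
            exact (hgq i hi hiq (hC _ _ hCij)).symm
          · simp only [hiq, hjq, if_false]
            exact h2 i (hsub i hi hiq).1 j (hsub j hj hjq).1 hij hCij

lemma conflict_card {k : ℕ} (S : Finset (Fin k)) (lab : Fin k × Bool → Fin k × Bool)
    (hf : ∀ l, ((S ×ˢ (Finset.univ : Finset Bool)).filter (fun q => lab q = l)).card ≤ 28)
    (i : Fin k) (hi : i ∈ S) :
    (S.filter (fun j => j ≠ i ∧ ∃ b b', lab (i, b) = lab (j, b'))).card ≤ 55 := by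
  have key : ∀ b, (((S ×ˢ (Finset.univ : Finset Bool)).filter
      (fun q => lab q = lab (i, b))).erase (i, b)).card ≤ 27 := by
    intro b
    rw [Finset.card_erase_of_mem (by simp [hi])]
    have := hf (lab (i, b)); omega
  have hsub : S.filter (fun j => j ≠ i ∧ ∃ b b', lab (i, b) = lab (j, b')) ⊆
      ((((S ×ˢ (Finset.univ : Finset Bool)).filter
      (fun q => lab q = lab (i, false))).erase (i, false)) ∪
      (((S ×ˢ (Finset.univ : Finset Bool)).filter
      (fun q => lab q = lab (i, true))).erase (i, true))).image Prod.fst := by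
    intro j hj
    simp only [Finset.mem_filter] at hj
    obtain ⟨hjS, hji, b, b', hb⟩ := hj
    rw [Finset.mem_image]
    refine ⟨(j, b'), ?_, rfl⟩
    cases b <;> simp [hjS, hji, hb]
  have h1 := (Finset.card_le_card hsub).trans (Finset.card_image_le.trans
    (Finset.card_union_le _ _))
  have := key true; have := key false
  omega

lemma Reach.contract {n : ℕ} {U : Finset (Fin n)} {E A : Finset (Sym2 (Fin n))}
    (h : LTree U E) {v w : Fin n} (hw : w ∈ U) (hv : v ∉ U) (hA : A ⊆ insert s(v, w) E)
    {x y : Fin n} (hr : Reach A x y) :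
    Reach (A.erase s(v, w)) (if x = v then w else x) (if y = v then w else y) := by
  have hwv : w ≠ v := by rintro rfl; exact hv hw
  unfold Reach at hr
  induction hr with
  | refl => exact Relation.ReflTransGen.refl
  | @tail b c _ hbc ih =>
    refine Relation.ReflTransGen.trans ih ?_
    by_cases he : s(b, c) = s(v, w)
    · have : (if b = v then w else b) = (if c = v then w else c) := by
        rw [Sym2.eq_iff] at he
        rcases he with ⟨rfl, rfl⟩ | ⟨rfl, rfl⟩ <;> simp [hwv]
      rw [this]
    · have hE : s(b, c) ∈ E := by
        have := hA hbc
        rw [Finset.mem_insert] at this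
        exact this.resolve_left he
      obtain ⟨h1, h2⟩ := h.mem b c hE
      have hb : b ≠ v := by rintro rfl; exact hv h1
      have hc : c ≠ v := by rintro rfl; exact hv h2
      simp only [hb, hc, if_false]
      exact Relation.ReflTransGen.single (by simp [he, hbc])

lemma Reach.leaf_mem {n : ℕ} {U : Finset (Fin n)} {E A : Finset (Sym2 (Fin n))}
    (h : LTree U E) {v w : Fin n} (hv : v ∉ U) (hA : A ⊆ insert s(v, w) E)
    {y : Fin n} (hy : y ≠ v) (hr : Reach A v y) : s(v, w) ∈ A := by
  unfold Reach at hr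
  rcases Relation.ReflTransGen.cases_head hr with h0 | ⟨c, hc, -⟩
  · exact absurd h0.symm hy
  · have := hA hc
    rw [Finset.mem_insert] at this
    rcases this with h1 | h1
    · rw [← h1]; exact hc
    · exact absurd (h.mem v c h1).1 hv

set_option maxHeartbeats 1000000 in
lemma colouring {n k : ℕ} {U : Finset (Fin n)} {E : Finset (Sym2 (Fin n))} (hT : LTree U E)
    (a : Sym2 (Fin n) → ℕ) :
    ∀ (S : Finset (Fin k)) (p : Fin k × Bool → Fin n) (lab : Fin k × Bool → Fin k × Bool)
      (A : Fin k → Finset (Sym2 (Fin n))),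
      (∀ e ∈ E, 1 ≤ a e) →
      (∀ i ∈ S, ∀ b, p (i, b) ∈ U) →
      (∀ i ∈ S, ∀ j ∈ S, ∀ b b', lab (i, b) = lab (j, b') → p (i, b) = p (j, b')) →
      (∀ l, ((S ×ˢ (Finset.univ : Finset Bool)).filter (fun q => lab q = l)).card ≤ 28) →
      (∀ i ∈ S, A i ⊆ E) →
      (∀ i ∈ S, Reach (A i) (p (i, false)) (p (i, true))) →
      (∀ e ∈ E, (S.filter (fun i => e ∈ A i)).card ≤ 14 * a e + 13) →
      ∃ (col : Fin k → Fin 56) (B : Fin k → Finset (Sym2 (Fin n))),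
        (∀ i ∈ S, B i ⊆ E) ∧ (∀ i ∈ S, Reach (B i) (p (i, false)) (p (i, true))) ∧
        (∀ γ, ∀ e ∈ E, (S.filter (fun i => col i = γ ∧ e ∈ B i)).card ≤ a e) ∧
        ∀ i ∈ S, ∀ j ∈ S, i ≠ j → (∃ b b', lab (i, b) = lab (j, b')) → col i ≠ col j := by
  induction hT with
  | single v =>
    intro S p lab A _ hp _ hf _ _ _
    obtain ⟨col, -, hcol⟩ := greedy (fun i j => ∃ b b', lab (i, b) = lab (j, b'))
      (fun i j ⟨b, b', h⟩ => ⟨b', b, h.symm⟩) S ∅ (by simp)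
      (fun i hi => by convert conflict_card S lab hf i hi) (fun _ => 0) (by simp)
    refine ⟨col, fun _ => ∅, by simp, fun i hi => ?_, by simp, hcol⟩
    have h1 := hp i hi false
    have h2 := hp i hi true
    rw [Finset.mem_singleton] at h1 h2
    rw [h1, h2]; exact Relation.ReflTransGen.refl
  | @add U E v w hT hw hv ih =>
    intro S p lab A ha hp hlp hf hA hR hcnt
    have hwv : w ≠ v := by rintro rfl; exact hv hw
    have hvwE : s(v, w) ∉ E := hT.notMem hv
    set S1 := S.filter (fun i => ¬ (p (i, false) = v ∧ p (i, true) = v)) with hS1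
    have hS1S : ∀ i ∈ S1, i ∈ S := fun i hi => (Finset.mem_filter.mp hi).1
    have hS1n : ∀ i ∈ S1, ∀ b b', p (i, b) = v → p (i, b') = v → b = b' := by
      intro i hi b b' h1 h2
      have := (Finset.mem_filter.mp hi).2
      cases b <;> cases b'
      · rfl
      · exact absurd ⟨h1, h2⟩ this
      · exact absurd ⟨h2, h1⟩ this
      · rfl
    set Xe := (S1 ×ˢ (Finset.univ : Finset Bool)).filter (fun q => p q = v) with hXe
    have hXe_mem : ∀ q, q ∈ Xe ↔ q.1 ∈ S1 ∧ p q = v := by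
      intro q; simp [hXe]
    have hXcard : Xe.card ≤ 14 * a s(v, w) + 13 := by
      refine le_trans (Finset.card_le_card_of_injOn Prod.fst ?_ ?_)
        (hcnt s(v, w) (Finset.mem_insert_self _ _))
      · rintro ⟨i, b⟩ hq
        have hq' := (hXe_mem _).mp (Finset.mem_coe.mp hq)
        have hiS := hS1S i hq'.1
        have hpv : p (i, b) = v := hq'.2
        rw [Finset.mem_coe, Finset.mem_filter]
        refine ⟨hiS, ?_⟩
        cases b
        · have h2 : p (i, true) ≠ v := fun h => by
            have := hS1n i hq'.1 _ _ hpv h; simp at this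
          have h3 := hR i hiS
          rw [hpv] at h3
          exact h3.leaf_mem hT hv (hA i hiS) h2
        · have h2 : p (i, false) ≠ v := fun h => by
            have := hS1n i hq'.1 _ _ hpv h; simp at this
          have h3 := (hR i hiS).symm
          rw [hpv] at h3
          exact h3.leaf_mem hT hv (hA i hiS) h2
      · rintro ⟨i, b⟩ hq ⟨j, b'⟩ hq' hij
        have h1 := (hXe_mem _).mp (Finset.mem_coe.mp hq)
        have h2 := (hXe_mem _).mp (Finset.mem_coe.mp hq')
        simp only at hij
        subst hij
        rw [hS1n i h1.1 b b' h1.2 h2.2]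
    have hsubX : Xe ⊆ S ×ˢ (Finset.univ : Finset Bool) := by
      intro q hq
      have := (hXe_mem q).mp hq
      simp [hS1S _ this.1]
    obtain ⟨g, hg1, hg2, hg3⟩ := merge Xe (a s(v, w)) (ha _ (Finset.mem_insert_self _ _)) hXcard
      _ lab rfl (fun l => (Finset.card_le_card (Finset.filter_subset_filter _ hsubX)).trans (hf l))
    -- labels of ends at `v` are mapped to labels which only occur at `v`
    have hgv : ∀ q ∈ Xe, ∀ q', q'.1 ∈ S → g (lab q) = lab q' → p q' = v := by
      intro q hq q' hq' h
      have h1 := hg1 q hq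
      rw [Finset.mem_image] at h1
      obtain ⟨q2, hq2, hq2l⟩ := h1
      have h2 := (hXe_mem q2).mp hq2
      rw [← h2.2]
      exact (hlp q2.1 (hS1S _ h2.1) q'.1 hq' q2.2 q'.2 (hq2l.trans h)).symm
    set lab' : Fin k × Bool → Fin k × Bool := fun q => if p q = v then g (lab q) else lab q
      with hlab'
    set p' : Fin k × Bool → Fin n := fun q => if p q = v then w else p q with hp'
    obtain ⟨col1, B1, hB1, hR1, hc1, hl1⟩ := ih S1 p' lab' (fun i => (A i).erase s(v, w))
      (fun e he => ha e (Finset.mem_insert_of_mem he))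
      (by
        intro i hi b
        have := hp i (hS1S i hi) b
        by_cases h : p (i, b) = v
        · simp only [hp', h, if_true]; exact hw
        · simp only [hp', h, if_false]
          exact (Finset.mem_insert.mp this).resolve_left h)
      (by
        intro i hi j hj b b' h
        by_cases h1 : p (i, b) = v <;> by_cases h2 : p (j, b') = v
        · simp only [hp', h1, h2, if_true]
        · simp only [hlab', h1, h2, if_true, if_false] at h
          exact absurd (hgv (i, b) ((hXe_mem _).mpr ⟨hi, h1⟩) (j, b') (hS1S j hj) h) h2
        · simp only [hlab', h1, h2, if_true, if_false] at h
          exact absurd (hgv (j, b') ((hXe_mem _).mpr ⟨hj, h2⟩) (i, b) (hS1S i hi) h.symm) h1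
        · simp only [hlab', h1, h2, if_false] at h
          simp only [hp', h1, h2, if_false]
          exact hlp i (hS1S i hi) j (hS1S j hj) b b' h)
      (by
        intro l
        by_cases hex : ∃ q ∈ Xe, g (lab q) = l
        · obtain ⟨q0, hq0, hq0l⟩ := hex
          refine le_trans (Finset.card_le_card ?_) (hg2 l)
          intro q hq
          simp only [Finset.mem_filter, Finset.mem_product, Finset.mem_univ, and_true] at hq
          rw [Finset.mem_filter]
          by_cases h : p q = v
          · simp only [hlab', h, if_true] at hq
            exact ⟨(hXe_mem q).mpr ⟨hq.1, h⟩, hq.2⟩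
          · simp only [hlab', h, if_false] at hq
            exact absurd (hgv q0 hq0 q (hS1S _ hq.1) (hq0l.trans hq.2.symm)) h
        · refine le_trans (Finset.card_le_card ?_) (hf l)
          intro q hq
          simp only [Finset.mem_filter, Finset.mem_product, Finset.mem_univ, and_true] at hq ⊢
          by_cases h : p q = v
          · simp only [hlab', h, if_true] at hq
            exact absurd ⟨q, (hXe_mem q).mpr ⟨hq.1, h⟩, hq.2⟩ hex
          · simp only [hlab', h, if_false] at hq
            exact ⟨hS1S _ hq.1, hq.2⟩)
      (by
        intro i hi e he
        rw [Finset.mem_erase] at he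
        exact (Finset.mem_insert.mp (hA i (hS1S i hi) he.2)).resolve_left he.1)
      (fun i hi => (hR i (hS1S i hi)).contract hT hw hv (hA i (hS1S i hi)))
      (by
        intro e he
        refine le_trans (Finset.card_le_card ?_) (hcnt e (Finset.mem_insert_of_mem he))
        intro i hi
        simp only [Finset.mem_filter, Finset.mem_erase] at hi ⊢
        exact ⟨hS1S i hi.1, hi.2.2⟩)
    obtain ⟨col, hcol1, hcol⟩ := greedy (fun i j => ∃ b b', lab (i, b) = lab (j, b'))
      (fun i j ⟨b, b', h⟩ => ⟨b', b, h.symm⟩) S S1 hS1S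
      (fun i hi => by convert conflict_card S lab hf i hi) col1 (by
        rintro i hi j hj hij ⟨b, b', h⟩
        refine hl1 i hi j hj hij ⟨b, b', ?_⟩
        have := hlp i (hS1S i hi) j (hS1S j hj) b b' h
        simp only [hlab', this, h])
    refine ⟨col, fun i => if i ∈ S1 then (if ∃ b, p (i, b) = v then insert s(v, w) (B1 i)
      else B1 i) else ∅, ?_, ?_, ?_, hcol⟩
    · intro i hi
      by_cases h1 : i ∈ S1
      · simp only [h1, if_true]
        split_ifs with h2
        · exact Finset.insert_subset_insert _ (hB1 i h1)
        · exact (hB1 i h1).trans (Finset.subset_insert _ _)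
      · simp only [h1, if_false]; simp
    · intro i hi
      by_cases h1 : i ∈ S1
      · simp only [h1, if_true]
        have h3 := hR1 i h1
        split_ifs with h2
        · have h4 : ∀ b, Reach (insert s(v, w) (B1 i)) (p (i, b)) (p' (i, b)) := by
            intro b
            by_cases h : p (i, b) = v
            · simp only [hp', h, if_true]
              exact Relation.ReflTransGen.single (by simp)
            · simp only [hp', h, if_false]; exact Relation.ReflTransGen.refl
          exact ((h4 false).trans (h3.mono (Finset.subset_insert _ _))).trans (h4 true).symm
        · push Not at h2
          simpa only [hp', h2, if_false] using h3
      · have : p (i, false) = v ∧ p (i, true) = v := by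
          by_contra h
          exact h1 (Finset.mem_filter.mpr ⟨hi, h⟩)
        rw [this.1, this.2]; exact Relation.ReflTransGen.refl
    · intro γ e he
      by_cases hev : e = s(v, w)
      · subst hev
        have hchar : ∀ i, (i ∈ S ∧ col i = γ ∧ s(v, w) ∈ (if i ∈ S1 then
            (if ∃ b, p (i, b) = v then insert s(v, w) (B1 i) else B1 i) else ∅)) →
            i ∈ S1 ∧ col1 i = γ ∧ p (i, decide (p (i, false) ≠ v)) = v := by
          rintro i ⟨hi, hc, hm⟩
          by_cases h1 : i ∈ S1
          · simp only [h1, if_true] at hm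
            refine ⟨h1, (hcol1 i h1).symm.trans hc, ?_⟩
            split_ifs at hm with h2
            · obtain ⟨b, hb⟩ := h2
              by_cases h : p (i, false) = v
              · simp [h]
              · cases b
                · exact absurd hb h
                · simp [h, hb]
            · exact absurd (hB1 i h1 hm) hvwE
          · simp [h1] at hm
        refine le_trans (Finset.card_le_card_of_injOn
          (fun i => g (lab (i, decide (p (i, false) ≠ v)))) ?_ ?_) hg3
        · intro i hi
          rw [Finset.mem_coe, Finset.mem_filter] at hi
          have := hchar i hi
          rw [Finset.mem_coe, Finset.mem_image]
          exact ⟨_, (hXe_mem _).mpr ⟨this.1, this.2.2⟩, rfl⟩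
        · intro i hi j hj hij
          rw [Finset.mem_coe, Finset.mem_filter] at hi hj
          obtain ⟨hi1, hi2, hi3⟩ := hchar i hi
          obtain ⟨hj1, hj2, hj3⟩ := hchar j hj
          by_contra hne
          refine hl1 i hi1 j hj1 hne ⟨decide (p (i, false) ≠ v),
            decide (p (j, false) ≠ v), ?_⟩ (hi2.trans hj2.symm)
          · simp only [hlab']
            rw [if_pos hi3, if_pos hj3]
            exact hij
      · have heE := (Finset.mem_insert.mp he).resolve_left hev
        refine le_trans (Finset.card_le_card ?_) (hc1 γ e heE)
        intro i hi
        rw [Finset.mem_filter] at hi ⊢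
        obtain ⟨hi, hc, hm⟩ := hi
        by_cases h1 : i ∈ S1
        · simp only [h1, if_true] at hm
          refine ⟨h1, (hcol1 i h1).symm.trans hc, ?_⟩
          split_ifs at hm with h2
          · exact (Finset.mem_insert.mp hm).resolve_left hev
          · exact hm
        · simp [h1] at hm

/-! ### Final assembly -/

lemma RoutableOn.rt {n k : ℕ} {H : SimpleGraph (Fin n)} {c c' : Sym2 (Fin n) → ℕ}
    {s t : Fin k → Fin n} {S : Finset (Fin k)} (hc : ∀ e ∈ H.edgeSet, c e ≤ c' e)
    (h : RoutableOn H c s t S) : Rt c' s t S := by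
  obtain ⟨P, -, hP⟩ := h
  refine ⟨fun i => if hi : i ∈ S then (P ⟨i, hi⟩).edges.toFinset else ∅, fun i hi => ?_,
    fun e => ?_⟩
  · simp only [hi, dif_pos]
    have key : ∀ (x y : Fin n) (W : H.Walk x y), Reach W.edges.toFinset x y := by
      intro x y W
      induction W with
      | nil => exact Relation.ReflTransGen.refl
      | @cons a b c hadj W ih =>
        refine Relation.ReflTransGen.head (b := b) (by simp) (Reach.mono ?_ ih)
        intro e he
        simp only [List.mem_toFinset, SimpleGraph.Walk.edges_cons, List.mem_cons] at he ⊢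
        exact Or.inr he
    exact key _ _ _
  · by_cases he : e ∈ H.edgeSet
    · refine le_trans ?_ ((hP e).trans (hc e he))
      rw [← Finset.card_map (Function.Embedding.subtype _)]
      refine Finset.card_le_card ?_
      intro i hi
      rw [Finset.mem_filter] at hi
      obtain ⟨hi, hm⟩ := hi
      simp only [hi, dif_pos, List.mem_toFinset] at hm
      rw [Finset.mem_map]
      exact ⟨⟨i, hi⟩, by simpa using hm, rfl⟩
    · rw [Finset.card_eq_zero.mpr]
      · exact Nat.zero_le _
      · rw [Finset.filter_eq_empty_iff]
        intro i hi hm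
        simp only [hi, dif_pos, List.mem_toFinset] at hm
        exact he (SimpleGraph.Walk.edges_subset_edgeSet _ hm)

lemma Reach.walk {n : ℕ} {H : SimpleGraph (Fin n)} {A : Finset (Sym2 (Fin n))}
    (hA : ∀ e ∈ A, e ∈ H.edgeSet) {x y : Fin n} (h : Reach A x y) :
    ∃ P : H.Walk x y, P.IsPath ∧ ∀ e ∈ P.edges, e ∈ A := by
  suffices h : ∃ P : H.Walk x y, ∀ e ∈ P.edges, e ∈ A by
    obtain ⟨P, hP⟩ := h
    exact ⟨P.bypass, P.bypass_isPath, fun e he => hP e (P.edges_bypass_subset_edges he)⟩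
  unfold Reach at h
  induction h with
  | refl => exact ⟨SimpleGraph.Walk.nil, by simp⟩
  | @tail b c _ hbc ih =>
    obtain ⟨P, hP⟩ := ih
    have hadj : H.Adj b c := by
      have := hA _ hbc
      rwa [SimpleGraph.mem_edgeSet] at this
    refine ⟨P.concat hadj, fun e he => ?_⟩
    rw [SimpleGraph.Walk.edges_concat, List.concat_eq_append, List.mem_append,
      List.mem_singleton] at he
    rcases he with he | rfl
    · exact hP e he
    · exact hbc

lemma Rt.routableOn {n k : ℕ} {H : SimpleGraph (Fin n)} {c c' : Sym2 (Fin n) → ℕ}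
    {s t : Fin k → Fin n} {S : Finset (Fin k)} (hc : ∀ e, c e ≤ c' e)
    (hH : ∀ e, c e ≠ 0 → e ∈ H.edgeSet) (h : Rt c s t S) : RoutableOn H c' s t S := by
  obtain ⟨A, h1, h2⟩ := h
  have h3 : ∀ i : {i : Fin k // i ∈ S}, ∃ P : H.Walk (s i.1) (t i.1),
      P.IsPath ∧ ∀ e ∈ P.edges, e ∈ A i.1 := by
    intro i
    refine (h1 i.1 i.2).walk (fun e he => hH e ?_)
    have : 0 < (S.filter (fun i => e ∈ A i)).card :=
      Finset.card_pos.mpr ⟨i.1, Finset.mem_filter.mpr ⟨i.2, he⟩⟩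
    have := h2 e
    omega
  choose P hP hPA using h3
  refine ⟨P, hP, fun e => le_trans ?_ ((h2 e).trans (hc e))⟩
  rw [← Finset.card_map (Function.Embedding.subtype _)]
  refine Finset.card_le_card ?_
  intro i hi
  rw [Finset.mem_map] at hi
  obtain ⟨j, hj, rfl⟩ := hi
  rw [Finset.mem_filter] at hj ⊢
  exact ⟨j.2, hPA j e hj.2⟩

lemma CLe.rt {n k : ℕ} {c d : Sym2 (Fin n) → ℕ} (h : CLe c d) {s t : Fin k → Fin n}
    {S : Finset (Fin k)} (hr : Rt c s t S) : Rt d s t S := by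
  have := h k s t S 0 (by simpa using hr)
  simpa using this

lemma exists_ltree {n : ℕ} {T : SimpleGraph (Fin n)} (hT : T.Connected)
    (F : Finset (Sym2 (Fin n))) (hF : ∀ e, e ∈ T.edgeSet → e ∈ F) :
    ∃ E ⊆ F, LTree Finset.univ E := by
  obtain ⟨v0⟩ := hT.nonempty
  have key : ∀ m : ℕ, 1 ≤ m → m ≤ n → ∃ U E, LTree U E ∧ E ⊆ F ∧ U.card = m := by
    intro m hm
    induction m, hm using Nat.le_induction with
    | base => intro _; exact ⟨{v0}, ∅, LTree.single v0, by simp, by simp⟩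
    | succ m hm ih =>
      intro hmn
      obtain ⟨U, E, h, hEF, hU⟩ := ih (by omega)
      obtain ⟨x, hx⟩ : U.Nonempty := by rw [← Finset.card_pos]; omega
      have hne : ∃ v w, w ∈ U ∧ v ∉ U ∧ T.Adj w v := by
        by_contra hcon
        push Not at hcon
        have hall : ∀ z, z ∈ (U : Set (Fin n)) := closed_univ hT (U : Set (Fin n))
          (fun a b hab ha => by
            by_contra hb
            exact hcon b a (by simpa using ha) (by simpa using hb) hab) (by simpa using hx)
        have : U = Finset.univ := Finset.eq_univ_iff_forall.mpr (fun z => by simpa using hall z)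
        rw [this, Finset.card_univ, Fintype.card_fin] at hU
        omega
      obtain ⟨v, w, hw, hv, hadj⟩ := hne
      refine ⟨_, _, h.add hw hv, ?_, ?_⟩
      · refine Finset.insert_subset (hF _ ?_) hEF
        rw [SimpleGraph.mem_edgeSet]; exact hadj.symm
      · rw [Finset.card_insert_of_notMem hv, hU]
  have hpos : 1 ≤ n := by have := v0.isLt; omega
  obtain ⟨U, E, h, hEF, hU⟩ := key n hpos le_rfl
  have : U = Finset.univ := by
    rw [← Finset.card_eq_iff_eq_univ, hU, Fintype.card_fin]
  subst this
  exact ⟨E, hEF, h⟩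

theorem stmt8 (n : ℕ) (hn : 2 ≤ n) (G : SimpleGraph (Fin n))
    (hconn : G.Connected) (hnc : NonCrossing n G.edgeSet)
    (u : Sym2 (Fin n) → ℕ) (hu : ∀ e ∈ G.edgeSet, 0 < u e)
    (k : ℕ) (sdem tdem : Fin k → Fin n)
    (w : Fin k → ℝ) (hw : ∀ i, 0 ≤ w i) :
    ∃ (T : SimpleGraph (Fin n)) (hatu : Sym2 (Fin n) → ℕ),
      T ≤ G ∧ T.IsTree ∧
      (∀ S : Finset (Fin k), RoutableOn T hatu sdem tdem S → RoutableOn G u sdem tdem S) ∧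
      (∀ S : Finset (Fin k), RoutableOn G u sdem tdem S →
        ∃ S' ⊆ S, RoutableOn T hatu sdem tdem S' ∧
          (1 / 56 : ℝ) * ∑ i ∈ S, w i ≤ ∑ i ∈ S', w i) := by
  classical
  set u0 : Sym2 (Fin n) → ℕ := fun e => if e ∈ G.edgeSet then u e else 0 with hu0d
  have hu0 : ∀ e, u0 e ≠ 0 ↔ e ∈ G.edgeSet := by
    intro e
    by_cases he : e ∈ G.edgeSet
    · have := hu e he
      simp only [hu0d, he, if_true, iff_true]; omega
    · simp [hu0d, he]
  have hu0le : ∀ e, u0 e ≤ u e := by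
    intro e
    by_cases he : e ∈ G.edgeSet <;> simp [hu0d, he]
  have hu0ge : ∀ e ∈ G.edgeSet, u e ≤ u0 e := by
    intro e he
    simp [hu0d, he]
  obtain ⟨a, x, ⟨hav, hax, hxa, hcard⟩, hau, hux⟩ := approximator hn hconn hnc u0 hu0
  set F : Finset (Sym2 (Fin n)) := Finset.univ.filter (fun e => a e ≠ 0) with hF
  set T : SimpleGraph (Fin n) := SimpleGraph.fromEdgeSet {e | a e ≠ 0} with hTd
  have hTe : ∀ e, e ∈ T.edgeSet ↔ a e ≠ 0 := by
    intro e
    rw [hTd, SimpleGraph.edgeSet_fromEdgeSet]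
    constructor
    · exact fun h => h.1
    · intro h
      exact ⟨h, fun hd => G.not_isDiag_of_mem_edgeSet ((hu0 e).mp (hav e h)) hd⟩
  have hTG : T ≤ G := by
    rw [← SimpleGraph.edgeSet_subset_edgeSet]
    intro e he
    exact (hu0 e).mp (hav e ((hTe e).mp he))
  have hxT : ∀ e, x e ≠ 0 → e ∈ T.edgeSet := fun e he =>
    (hTe e).mpr (fun h => he (hax e h))
  have hTconn : T.Connected := by
    have : Nonempty (Fin n) := hconn.nonempty
    refine SimpleGraph.Connected.mk (fun p q => ?_)
    obtain ⟨W⟩ := hconn.preconnected p q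
    have h1 : RoutableOn G u (k := 1) (fun _ => p) (fun _ => q) Finset.univ := by
      refine ⟨fun _ => W.bypass, fun _ => W.bypass_isPath, fun e => ?_⟩
      by_cases he : e ∈ W.bypass.edges
      · have := hu e (SimpleGraph.Walk.edges_subset_edgeSet _ he)
        refine (Finset.card_filter_le _ _).trans ?_
        simp
        omega
      · simp [he]
    have h2 := (hux.rt (h1.rt hu0ge)).routableOn (fun _ => le_rfl) hxT
    obtain ⟨P, -, -⟩ := h2
    exact ⟨P ⟨0, Finset.mem_univ _⟩⟩
  have hFe : ∀ e, e ∈ F ↔ a e ≠ 0 := by intro e; simp [hF]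
  obtain ⟨E, hEF, hL⟩ := exists_ltree hTconn F (fun e he => (hFe e).mpr ((hTe e).mp he))
  have hEc := hL.card
  rw [Finset.card_univ, Fintype.card_fin] at hEc
  have hEF' : E = F := Finset.eq_of_subset_of_card_le hEF (by omega)
  rw [hEF'] at hL hEc
  refine ⟨T, a, hTG, ?_, ?_, ?_⟩
  · rw [SimpleGraph.isTree_iff_connected_and_card]
    refine ⟨hTconn, ?_⟩
    have : T.edgeSet = (F : Set (Sym2 (Fin n))) := by
      ext e; rw [hTe, Finset.mem_coe, hFe]
    rw [this, Nat.card_eq_fintype_card, Nat.card_eq_fintype_card, Fintype.card_fin]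
    simpa using hEc
  · intro S hS
    exact (hau.rt (hS.rt (fun e _ => le_rfl))).routableOn hu0le (fun e he => (hu0 e).mp he)
  · intro S hS
    obtain ⟨A, hA1, hA2⟩ := hux.rt (hS.rt hu0ge)
    obtain ⟨col, B, hB1, hB2, hB3, -⟩ := colouring hL a S
      (fun q => if q.2 then tdem q.1 else sdem q.1) id A
      (fun e he => Nat.one_le_iff_ne_zero.mpr ((hFe e).mp he)) (by simp)
      (by
        intro i _ j _ b b' h
        simp only [id] at h
        rw [h])
      (by
        intro l
        refine (Finset.card_le_one.mpr ?_).trans (by norm_num)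
        intro q hq q' hq'
        rw [Finset.mem_filter] at hq hq'
        exact hq.2.trans hq'.2.symm)
      (by
        intro i hi e he
        rw [hFe, ← hTe]
        refine hxT e ?_
        have : 0 < (S.filter (fun i => e ∈ A i)).card :=
          Finset.card_pos.mpr ⟨i, Finset.mem_filter.mpr ⟨hi, he⟩⟩
        have := hA2 e
        omega)
      (by simpa using hA1)
      (fun e _ => (hA2 e).trans (hxa e))
    have hsum : ∑ γ : Fin 56, ∑ i ∈ S.filter (fun i => col i = γ), w i = ∑ i ∈ S, w i :=
      Finset.sum_fiberwise S col w
    obtain ⟨γ, hγ⟩ : ∃ γ : Fin 56, (1 / 56 : ℝ) * ∑ i ∈ S, w i ≤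
        ∑ i ∈ S.filter (fun i => col i = γ), w i := by
      by_contra hcon
      push Not at hcon
      have h := Finset.sum_lt_sum_of_nonempty (Finset.univ_nonempty (α := Fin 56))
        (fun γ _ => hcon γ)
      rw [hsum, Finset.sum_const, Finset.card_univ, Fintype.card_fin, nsmul_eq_mul] at h
      push_cast at h
      linarith
    refine ⟨S.filter (fun i => col i = γ), Finset.filter_subset _ _, ?_, hγ⟩
    refine Rt.routableOn (c := a) (fun _ => le_rfl) (fun e he => (hTe e).mpr he)
      ⟨B, fun i hi => ?_, fun e => ?_⟩
    · simpa using hB2 i (Finset.mem_filter.mp hi).1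
    · by_cases he : e ∈ F
      · rw [Finset.filter_filter]
        exact hB3 γ e he
      · rw [Finset.card_eq_zero.mpr]
        · exact Nat.zero_le _
        · rw [Finset.filter_eq_empty_iff]
          intro i hi hm
          exact he (hB1 i (Finset.mem_filter.mp hi).1 hm)
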